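/- Let V₈ = ℂ⁸ with standard basis v₁,…,v₈ and let y₃ := v₁∧v₂∧v₃ + v₄∧v₅∧v₆ + v₁∧v₄∧v₇ + v₂∧v₆∧v₈ + v₃∧v₅∧v₈ ∈ ⋀³V₈. For every g ∈ GL(V₈), setting y := (⋀³g)(y₃), there exist exactly two pairs of subspaces (V₁, V₄) with dim V₁ = 1, dim V₄ = 4, V₁ ⊆ V₄ ⊆ V₈ such that y ∈ V₁∧⋀²V₈ + ⋀²V₄∧V₈. Moreover, for g = id these two pairs are (span{v₁}, span{v₁,v₅,v₆,v₈}) and (span{v₄}, span{v₂,v₃,v₄,v₈}). -/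

import Mathlib

open ExteriorAlgebra

noncomputable section

/-- `V₈ = ℂ⁸`. -/
abbrev V8 : Type := Fin 8 → ℂ

/-- The standard basis vectors of `ℂ⁸`; `v i` corresponds to `v_{i+1}` of the paper. -/
def v (i : Fin 8) : V8 := Pi.single i 1

/-- For subspaces `S, T, U` of `W = ℂ⁸`, the subspace `S∧T∧U` of `⋀³W`, realized as the span,
inside the exterior algebra, of all products `s∧t∧u` with `s ∈ S`, `t ∈ T`, `u ∈ U`.
In particular `wSpan S ⊤ ⊤ = S∧⋀²V₈` and `wSpan S S ⊤ = ⋀²S∧V₈`. -/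
def wSpan (S T U : Submodule ℂ V8) : Submodule ℂ (ExteriorAlgebra ℂ V8) :=
  Submodule.span ℂ {x | ∃ s ∈ S, ∃ t ∈ T, ∃ u ∈ U, x = ι ℂ s * ι ℂ t * ι ℂ u}

/-- The representative `y₃ = v₁∧v₂∧v₃ + v₄∧v₅∧v₆ + v₁∧v₄∧v₇ + v₂∧v₆∧v₈ + v₃∧v₅∧v₈`
of the open orbit of the orbit closure `Y₃ ⊂ ⋀³ℂ⁸` (with 0-based indices). -/
def y3 : ExteriorAlgebra ℂ V8 :=
  ι ℂ (v 0) * ι ℂ (v 1) * ι ℂ (v 2) + ι ℂ (v 3) * ι ℂ (v 4) * ι ℂ (v 5) +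
  ι ℂ (v 0) * ι ℂ (v 3) * ι ℂ (v 6) + ι ℂ (v 1) * ι ℂ (v 5) * ι ℂ (v 7) +
  ι ℂ (v 2) * ι ℂ (v 4) * ι ℂ (v 7)

/-- The set of pairs `(V₁, V₄)` with `dim V₁ = 1`, `dim V₄ = 4`, `V₁ ⊆ V₄` and
`y ∈ V₁∧⋀²V₈ + ⋀²V₄∧V₈`. -/
def pairs14 (y : ExteriorAlgebra ℂ V8) : Set (Submodule ℂ V8 × Submodule ℂ V8) :=
  {P | Module.finrank ℂ P.1 = 1 ∧ Module.finrank ℂ P.2 = 4 ∧ P.1 ≤ P.2 ∧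
    y ∈ wSpan P.1 ⊤ ⊤ ⊔ wSpan P.2 P.2 ⊤}

section LinearForms

variable {U : Type*} [AddCommGroup U] [Module ℂ U]

/-- The value at `(a, b)` of the wedge product of two linear forms. -/
def wedge (f g : Module.Dual ℂ U) (a b : U) : ℂ := f a * g b - f b * g a

theorem exists_ne_zero_forms_eq_zero (hU : Module.finrank ℂ U = 4) (f g h : Module.Dual ℂ U) :
    ∃ u : U, u ≠ 0 ∧ f u = 0 ∧ g u = 0 ∧ h u = 0 := by
  have : FiniteDimensional ℂ U := Module.finite_of_finrank_pos (by omega)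
  have hker : LinearMap.ker (LinearMap.pi ![f, g, h]) ≠ ⊥ :=
    LinearMap.ker_ne_bot_of_finrank_lt (by simp [hU])
  obtain ⟨u, hu, hu0⟩ := Submodule.exists_mem_ne_zero_of_ne_bot hker
  have hv := fun i => congrFun (LinearMap.mem_ker.1 hu) i
  exact ⟨u, hu0, by simpa using hv 0, by simpa using hv 1, by simpa using hv 2⟩

theorem exists_form_of_wedge_eq_zero (p : U → Prop) (f g : Module.Dual ℂ U)
    (h : ∀ a b, p a → p b → wedge f g a b = 0) :
    ∃ k : Module.Dual ℂ U, ∀ u, p u → k u = 0 → f u = 0 ∧ g u = 0 := by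
  by_cases hf : ∃ a, p a ∧ f a ≠ 0
  · obtain ⟨a, ha, hfa⟩ := hf
    refine ⟨f, fun u hu hfu => ⟨hfu, ?_⟩⟩
    have := h a u ha hu
    simp only [wedge, hfu, zero_mul, sub_zero] at this
    exact (mul_eq_zero.1 this).resolve_left hfa
  · push Not at hf
    exact ⟨g, fun u hu hgu => ⟨hf u hu, hgu⟩⟩

theorem exists_form_of_wedge_eq_mul {κ : Type*} (p : U → Prop) (f : κ → Module.Dual ℂ U)
    (g : Module.Dual ℂ U) (c : κ → ℂ) (L : U → U → ℂ)
    (h : ∀ j a b, p a → p b → wedge (f j) g a b = c j * L a b)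
    {u₀ : U} (hu₀ : p u₀) (hg : g u₀ ≠ 0) :
    ∃ k : Module.Dual ℂ U, ∀ u, p u → g u = 0 → k u = 0 → ∀ j, f j u = 0 := by
  by_cases hc : ∃ i, c i ≠ 0
  · obtain ⟨i, hi⟩ := hc
    refine ⟨f i, fun u hu hgu hfu j => ?_⟩
    have hL := h i u u₀ hu hu₀
    simp only [wedge, hgu, hfu, zero_mul, mul_zero, sub_zero] at hL
    have hj := h j u u₀ hu hu₀
    rw [(mul_eq_zero.1 hL.symm).resolve_left hi] at hj
    simpa [wedge, hgu, hg] using hj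
  · push Not at hc
    refine ⟨0, fun u hu hgu _ j => ?_⟩
    have hj := h j u u₀ hu hu₀
    simpa [wedge, hgu, hg, hc j] using hj

/-- Eight linear forms `x i` separating the points of a space `U`, such that the contraction of
the 3-form `x₀x₁x₂ + x₃x₄x₅ + x₀x₃x₆ + x₁x₅x₇ + x₂x₄x₇` with any two vectors of `U` is a multiple
of `∑ i, w i • x i`, a combination which vanishes. -/
structure IsDegenerate (x : Fin 8 → Module.Dual ℂ U) (L : U → Module.Dual ℂ U)
    (w : Fin 8 → ℂ) : Prop where
  eq_zero : ∀ u, (∀ i, x i u = 0) → u = 0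
  relation : ∀ u, ∑ i, w i * x i u = 0
  coeff0 : ∀ a b, wedge (x 1) (x 2) a b + wedge (x 3) (x 6) a b = w 0 * L a b
  coeff1 : ∀ a b, wedge (x 5) (x 7) a b - wedge (x 0) (x 2) a b = w 1 * L a b
  coeff2 : ∀ a b, wedge (x 0) (x 1) a b + wedge (x 4) (x 7) a b = w 2 * L a b
  coeff3 : ∀ a b, wedge (x 4) (x 5) a b - wedge (x 0) (x 6) a b = w 3 * L a b
  coeff4 : ∀ a b, - wedge (x 3) (x 5) a b - wedge (x 2) (x 7) a b = w 4 * L a b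
  coeff5 : ∀ a b, wedge (x 3) (x 4) a b - wedge (x 1) (x 7) a b = w 5 * L a b
  coeff6 : ∀ a b, wedge (x 0) (x 3) a b = w 6 * L a b
  coeff7 : ∀ a b, wedge (x 1) (x 5) a b + wedge (x 2) (x 4) a b = w 7 * L a b

namespace IsDegenerate

variable {x : Fin 8 → Module.Dual ℂ U} {L : U → Module.Dual ℂ U} {w : Fin 8 → ℂ}

theorem eq_zero' (h : IsDegenerate x L w) {u : U} (h0 : x 0 u = 0) (h1 : x 1 u = 0)
    (h2 : x 2 u = 0) (h3 : x 3 u = 0) (h4 : x 4 u = 0) (h5 : x 5 u = 0) (h6 : x 6 u = 0)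
    (h7 : x 7 u = 0) : u = 0 :=
  h.eq_zero u fun i => by fin_cases i <;> assumption

theorem swap (h : IsDegenerate x L w) :
    IsDegenerate ![x 3, x 4, x 5, x 0, x 1, x 2, -x 6, -x 7] L
      ![w 3, w 4, w 5, w 0, w 1, w 2, -w 6, -w 7] where
  eq_zero u hu := by
    simp only [Fin.forall_fin_succ, Fin.isValue] at hu
    simp at hu
    apply h.eq_zero' <;> tauto
  relation u := by
    have := h.relation u
    simp [Fin.sum_univ_succ, Fin.succ] at this ⊢
    linear_combination this
  coeff0 a b := by
    have := h.coeff3 a b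
    simp [wedge] at this ⊢
    linear_combination this
  coeff1 a b := by
    have := h.coeff4 a b
    simp [wedge] at this ⊢
    linear_combination this
  coeff2 a b := by
    have := h.coeff5 a b
    simp [wedge] at this ⊢
    linear_combination this
  coeff3 a b := by
    have := h.coeff0 a b
    simp [wedge] at this ⊢
    linear_combination this
  coeff4 a b := by
    have := h.coeff1 a b
    simp [wedge] at this ⊢
    linear_combination this
  coeff5 a b := by
    have := h.coeff2 a b
    simp [wedge] at this ⊢
    linear_combination this
  coeff6 a b := by
    have := h.coeff6 a b
    simp [wedge] at this ⊢
    linear_combination -this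
  coeff7 a b := by
    have := h.coeff7 a b
    simp [wedge] at this ⊢
    linear_combination -this

theorem wedge_zero_three (hU : Module.finrank ℂ U = 4) (h : IsDegenerate x L w) (a b : U) :
    wedge (x 0) (x 3) a b = 0 := by
  by_contra hab
  have hw : w 6 ≠ 0 := fun hw => hab (by rw [h.coeff6, hw, zero_mul])
  have hL : ∀ u, x 0 u = 0 → x 3 u = 0 → ∀ v, L v u = 0 := fun u h0 h3 v => by
    have := h.coeff6 v u
    simpa [wedge, h0, h3, hw] using this
  have h6 : ∀ u, x 0 u = 0 → x 1 u = 0 → x 2 u = 0 → x 3 u = 0 → x 4 u = 0 → x 5 u = 0 →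
      x 7 u = 0 → u = 0 := fun u h0 h1 h2 h3 h4 h5 h7 => by
    refine h.eq_zero' h0 h1 h2 h3 h4 h5 ?_ h7
    have := h.relation u
    simpa [Fin.sum_univ_eight, h0, h1, h2, h3, h4, h5, h7, hw] using this
  have h7 : ∀ u, x 0 u = 0 → x 3 u = 0 → x 7 u = 0 := by
    by_contra! hne
    obtain ⟨u₀, h00, h30, h70⟩ := hne
    obtain ⟨u, hu, h0, h3, h7⟩ := exists_ne_zero_forms_eq_zero hU (x 0) (x 3) (x 7)
    refine hu (h6 u h0 ?_ ?_ h3 ?_ ?_ h7)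
    · have := h.coeff5 u₀ u
      simpa [wedge, h0, h3, h7, h00, h30, h70, hL u h0 h3] using this
    · have := h.coeff4 u₀ u
      simpa [wedge, h0, h3, h7, h00, h30, h70, hL u h0 h3] using this
    · have := h.coeff2 u₀ u
      simpa [wedge, h0, h3, h7, h00, h30, h70, hL u h0 h3] using this
    · have := h.coeff1 u₀ u
      simpa [wedge, h0, h3, h7, h00, h30, h70, hL u h0 h3] using this
  obtain ⟨k, hk⟩ := exists_form_of_wedge_eq_zero (fun u => x 0 u = 0 ∧ x 3 u = 0) (x 4) (x 5)
    (fun a b ha hb => by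
      have := h.coeff3 a b
      simpa [wedge, ha.1, hb.1, hL b hb.1 hb.2] using this)
  obtain ⟨u, hu, h0, h3, hku⟩ := exists_ne_zero_forms_eq_zero hU (x 0) (x 3) k
  obtain ⟨h4, h5⟩ := hk u ⟨h0, h3⟩ hku
  have hx : ∃ c, x 0 c ≠ 0 := by
    by_contra! hc
    exact hab (by simp [wedge, hc])
  obtain ⟨c, hc⟩ := hx
  refine hu (h6 u h0 ?_ ?_ h3 h4 h5 (h7 u h0 h3))
  · have := h.coeff2 c u
    simpa [wedge, h0, h4, hc, h7 u h0 h3, hL u h0 h3] using this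
  · have := h.coeff1 c u
    simpa [wedge, h0, h5, hc, h7 u h0 h3, hL u h0 h3] using this

theorem not_forall_eq_zero (hU : Module.finrank ℂ U = 4) (h : IsDegenerate x L w)
    (h0 : ∀ u, x 0 u = 0) (h3 : ∀ u, x 3 u = 0) : False := by
  have h7 : ∀ u, x 7 u = 0 := by
    by_contra! hne
    obtain ⟨u₀, hu₀⟩ := hne
    obtain ⟨k, hk⟩ := exists_form_of_wedge_eq_mul (fun _ => True) ![x 1, x 2, x 4, x 5] (x 7)
      ![-w 5, -w 4, w 2, w 1] (fun a b => L a b) (fun j a b _ _ => by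
        have := h.coeff5 a b
        have := h.coeff4 a b
        have := h.coeff2 a b
        have := h.coeff1 a b
        fin_cases j <;> simp_all [wedge] <;> grind) trivial hu₀
    obtain ⟨u, hu, h6, h7, hku⟩ := exists_ne_zero_forms_eq_zero hU (x 6) (x 7) k
    have := hk u trivial h7 hku
    exact hu (h.eq_zero' (h0 u) (this 0) (this 1) (h3 u) (this 2) (this 3) h6 h7)
  have h12 : ∀ a b, wedge (x 1) (x 2) a b = 0 := by
    by_contra! hne
    obtain ⟨a, b, hab⟩ := hne
    have h0' := h.coeff0
    simp only [wedge, h3, zero_mul, sub_zero, add_zero] at h0' hab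
    have hw : w 0 ≠ 0 := fun hw => hab (by simp [h0', hw])
    obtain ⟨u, hu, h1, h2, h6⟩ := exists_ne_zero_forms_eq_zero hU (x 1) (x 2) (x 6)
    have hL : ∀ v, L v u = 0 := fun v => by simpa [h1, h2, hw] using h0' v u
    have ha := h.coeff7 a u
    have hb := h.coeff7 b u
    simp only [wedge, h1, h2, hL, zero_mul, mul_zero, sub_zero] at ha hb
    refine hu (h.eq_zero' (h0 u) h1 h2 (h3 u) ?_ ?_ h6 (h7 u))
    · refine (mul_eq_zero.1 ?_).resolve_left hab
      linear_combination x 1 a * hb - x 1 b * ha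
    · refine (mul_eq_zero.1 ?_).resolve_left hab
      linear_combination x 2 b * ha - x 2 a * hb
  have h45 : ∀ a b, wedge (x 4) (x 5) a b = 0 := by
    by_contra! hne
    obtain ⟨a, b, hab⟩ := hne
    have h0' := h.coeff3
    simp only [wedge, h0, zero_mul, sub_zero] at h0' hab
    have hw : w 3 ≠ 0 := fun hw => hab (by simp [h0', hw])
    obtain ⟨u, hu, h4, h5, h6⟩ := exists_ne_zero_forms_eq_zero hU (x 4) (x 5) (x 6)
    have hL : ∀ v, L v u = 0 := fun v => by simpa [h4, h5, hw] using h0' v u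
    have ha := h.coeff7 a u
    have hb := h.coeff7 b u
    simp only [wedge, h4, h5, hL, mul_zero, zero_sub] at ha hb
    refine hu (h.eq_zero' (h0 u) ?_ ?_ (h3 u) h4 h5 h6 (h7 u))
    · refine (mul_eq_zero.1 ?_).resolve_left hab
      linear_combination x 4 b * ha - x 4 a * hb
    · refine (mul_eq_zero.1 ?_).resolve_left hab
      linear_combination x 5 a * hb - x 5 b * ha
  obtain ⟨k, hk⟩ := exists_form_of_wedge_eq_zero (fun _ => True) (x 1) (x 2)
    (fun a b _ _ => h12 a b)
  obtain ⟨l, hl⟩ := exists_form_of_wedge_eq_zero (fun _ => True) (x 4) (x 5)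
    (fun a b _ _ => h45 a b)
  obtain ⟨u, hu, hku, hlu, h6⟩ := exists_ne_zero_forms_eq_zero hU k l (x 6)
  obtain ⟨h1, h2⟩ := hk u trivial hku
  obtain ⟨h4, h5⟩ := hl u trivial hlu
  exact hu (h.eq_zero' (h0 u) h1 h2 (h3 u) h4 h5 h6 (h7 u))

theorem eq_zero_of_apply_ne_zero (hU : Module.finrank ℂ U = 4) (h : IsDegenerate x L w)
    {a : U} (ha : x 0 a ≠ 0) :
    (∀ u, x 1 u = 0 ∧ x 2 u = 0 ∧ x 3 u = 0 ∧ x 7 u = 0) ∧ ∀ i, i ≠ 3 → w i = 0 := by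
  have h03 := h.wedge_zero_three hU
  wlog ha1 : x 0 a = 1 generalizing a
  · exact this (a := (x 0 a)⁻¹ • a) (by simp [ha]) (by simp [ha])
  obtain ⟨s, hs⟩ : ∃ s, ∀ u, x 3 u = s * x 0 u := ⟨x 3 a, fun u => by
    have := h03 a u
    simp only [wedge, ha1] at this
    linear_combination this⟩
  have h7T : ∀ u, x 0 u = 0 → x 7 u = 0 := by
    by_contra! hne
    obtain ⟨u₀, h00, h70⟩ := hne
    obtain ⟨k, hk⟩ := exists_form_of_wedge_eq_mul (fun u => x 0 u = 0) ![x 1, x 2, x 4, x 5] (x 7)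
      ![-w 5, -w 4, w 2, w 1] (fun a b => L a b) (fun j a b ha hb => by
        have := h.coeff5 a b
        have := h.coeff4 a b
        have := h.coeff2 a b
        have := h.coeff1 a b
        fin_cases j <;> simp_all [wedge] <;> grind) h00 h70
    obtain ⟨u, hu, h0, h7, hku⟩ := exists_ne_zero_forms_eq_zero hU (x 0) (x 7) k
    have hx := hk u h0 h7 hku
    have h1 : x 1 u = 0 := hx 0
    have h2 : x 2 u = 0 := hx 1
    have h4 : x 4 u = 0 := hx 2
    have h5 : x 5 u = 0 := hx 3
    have h3 : x 3 u = 0 := by simp [hs, h0]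
    have h6 : x 6 u ≠ 0 := fun h6 => hu (h.eq_zero' h0 h1 h2 h3 h4 h5 h6 h7)
    have hL : L a u ≠ 0 := fun hL => h6 (by
      have := h.coeff3 a u
      simpa [wedge, h0, h4, h5, hL, ha1] using this)
    have hw1 : w 1 = 0 := by
      have := h.coeff1 a u
      simpa [wedge, h0, h2, h5, h7, hL] using this
    have hw2 : w 2 = 0 := by
      have := h.coeff2 a u
      simpa [wedge, h0, h1, h4, h7, hL] using this
    have hw4 : w 4 = 0 := by
      have := h.coeff4 a u
      simpa [wedge, h3, h5, h2, h7, hL] using this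
    have hw5 : w 5 = 0 := by
      have := h.coeff5 a u
      simpa [wedge, h3, h4, h1, h7, hL] using this
    obtain ⟨v, hv, hv0, hv7, hv6⟩ := exists_ne_zero_forms_eq_zero hU (x 0) (x 7) (x 6)
    have hv3 : x 3 v = 0 := by simp [hs, hv0]
    have h30 : x 3 u₀ = 0 := by simp [hs, h00]
    refine hv (h.eq_zero' hv0 ?_ ?_ hv3 ?_ ?_ hv6 hv7)
    · have := h.coeff5 u₀ v
      simpa [wedge, hv0, hv3, hv7, h00, h30, h70, hw5] using this
    · have := h.coeff4 u₀ v
      simpa [wedge, hv0, hv3, hv7, h00, h30, h70, hw4] using this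
    · have := h.coeff2 u₀ v
      simpa [wedge, hv0, hv3, hv7, h00, h30, h70, hw2] using this
    · have := h.coeff1 u₀ v
      simpa [wedge, hv0, hv3, hv7, h00, h30, h70, hw1] using this
  obtain ⟨e, he⟩ : ∃ e, ∀ u, x 7 u = e * x 0 u := ⟨x 7 a, fun u => by
    have := h7T (u - x 0 u • a) (by simp [ha1])
    simp only [map_sub, map_smul, smul_eq_mul] at this
    linear_combination this⟩
  have hLT : ∃ b c, x 0 b = 0 ∧ x 0 c = 0 ∧ L b c ≠ 0 := by
    by_contra! hL
    obtain ⟨k, hk⟩ := exists_form_of_wedge_eq_zero (fun u => x 0 u = 0) (x 4) (x 5)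
      (fun b c hb hc => by
        have := h.coeff3 b c
        simpa [wedge, hb, hc, hL b c hb hc] using this)
    obtain ⟨u, hu, h0, hku, hLu⟩ := exists_ne_zero_forms_eq_zero hU (x 0) k (L a)
    obtain ⟨h4, h5⟩ := hk u h0 hku
    refine hu (h.eq_zero' h0 ?_ ?_ (by simp [hs, h0]) h4 h5 ?_ (h7T u h0))
    · have := h.coeff2 a u
      simpa [wedge, h0, h4, hLu, ha1, h7T u h0] using this
    · have := h.coeff1 a u
      simpa [wedge, h0, h5, hLu, ha1, h7T u h0] using this
    · have := h.coeff3 a u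
      simpa [wedge, h0, h4, h5, hLu, ha1] using this
  obtain ⟨b, c, hb, hc, hLbc⟩ := hLT
  have hw1 : w 1 = 0 := by
    have := h.coeff1 b c
    simpa [wedge, he, hb, hc, hLbc] using this
  have hw2 : w 2 = 0 := by
    have := h.coeff2 b c
    simpa [wedge, he, hb, hc, hLbc] using this
  have hw4 : w 4 = 0 := by
    have := h.coeff4 b c
    simpa [wedge, he, hs, hb, hc, hLbc] using this
  have hw5 : w 5 = 0 := by
    have := h.coeff5 b c
    simpa [wedge, he, hs, hb, hc, hLbc] using this
  have hw6 : w 6 = 0 := by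
    have := h.coeff6 b c
    simpa [wedge, hs, hb, hc, hLbc] using this
  have h1T : ∀ u, x 0 u = 0 → x 1 u = e * x 4 u := fun u h0 => by
    have := h.coeff2 a u
    simp only [wedge, he, h0, ha1, hw2] at this
    linear_combination this
  have h2T : ∀ u, x 0 u = 0 → x 2 u = - e * x 5 u := fun u h0 => by
    have := h.coeff1 a u
    simp only [wedge, he, h0, ha1, hw1] at this
    linear_combination -this
  have h5T : ∀ u, x 0 u = 0 → (s + e ^ 2) * x 5 u = 0 := fun u h0 => by
    have := h.coeff4 a u
    simp only [wedge, he, hs, h0, ha1, hw4, h2T u h0] at this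
    linear_combination -this
  have h4T : ∀ u, x 0 u = 0 → (s + e ^ 2) * x 4 u = 0 := fun u h0 => by
    have := h.coeff5 a u
    simp only [wedge, he, hs, h0, ha1, hw5, h1T u h0] at this
    linear_combination this
  obtain ⟨p, q, hp, hq, hpq⟩ :
      ∃ p q, x 0 p = 0 ∧ x 0 q = 0 ∧ wedge (x 4) (x 5) p q ≠ 0 := by
    by_contra! hne
    obtain ⟨k, hk⟩ := exists_form_of_wedge_eq_zero (fun u => x 0 u = 0) (x 4) (x 5)
      (fun b c hb hc => hne b c hb hc)
    obtain ⟨u, hu, h0, hku, h6⟩ := exists_ne_zero_forms_eq_zero hU (x 0) k (x 6)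
    obtain ⟨h4, h5⟩ := hk u h0 hku
    exact hu (h.eq_zero' h0 (by simp [h1T u h0, h4]) (by simp [h2T u h0, h5])
      (by simp [hs, h0]) h4 h5 h6 (h7T u h0))
  have hse : s + e ^ 2 = 0 := by
    refine (mul_eq_zero.1 ?_).resolve_right hpq
    simp only [wedge]
    linear_combination x 5 q * h4T p hp - x 5 p * h4T q hq
  have hw0 : w 0 = - e ^ 2 * w 3 := by
    refine mul_right_cancel₀ hLbc ?_
    have h0' := h.coeff0 b c
    have h3' := h.coeff3 b c
    simp only [wedge, hs, hb, hc, h1T b hb, h1T c hc, h2T b hb, h2T c hc] at h0' h3'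
    linear_combination -h0' - e ^ 2 * h3'
  obtain ⟨u, hu, h0, h4, h5⟩ := exists_ne_zero_forms_eq_zero hU (x 0) (x 4) (x 5)
  have h1 : x 1 u = 0 := by simp [h1T u h0, h4]
  have h2 : x 2 u = 0 := by simp [h2T u h0, h5]
  have h6 : x 6 u ≠ 0 := fun h6 =>
    hu (h.eq_zero' h0 h1 h2 (by simp [hs, h0]) h4 h5 h6 (h7T u h0))
  have hLu := h.coeff3 a u
  have hLu' := h.coeff0 a u
  have hLu'' := h.coeff7 a u
  simp only [wedge, h0, h1, h2, h4, h5, ha1, hs, hw0] at hLu hLu' hLu''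
  have hLau : L a u ≠ 0 := fun hL => h6 (by simpa [hL] using hLu)
  have hw7 : w 7 = 0 := by simpa [hLau] using hLu''
  have he0 : e = 0 := by
    have : 2 * e ^ 2 * x 6 u = 0 := by
      linear_combination x 6 u * hse - hLu' - e ^ 2 * hLu
    simpa [h6] using this
  have hs0 : s = 0 := by simpa [he0] using hse
  subst he0 hs0
  have hap := h.coeff7 a p
  have haq := h.coeff7 a q
  simp only [wedge, hw7, h1T p hp, h1T q hq, h2T p hp, h2T q hq] at hap haq hpq
  have h1a : x 1 a = 0 := by
    refine (mul_eq_zero.1 ?_).resolve_right hpq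
    linear_combination x 4 p * haq - x 4 q * hap
  have h2a : x 2 a = 0 := by
    refine (mul_eq_zero.1 ?_).resolve_right hpq
    linear_combination x 5 q * hap - x 5 p * haq
  refine ⟨fun u => ⟨?_, ?_, by simp [hs], by simp [he]⟩, fun i hi => ?_⟩
  · have := h1T (u - x 0 u • a) (by simp [ha1])
    simpa [h1a] using this
  · have := h2T (u - x 0 u • a) (by simp [ha1])
    simpa [h2a] using this
  · have hw0' : w 0 = 0 := by simpa using hw0
    fin_cases i <;> first | assumption | exact absurd rfl hi

theorem cases (hU : Module.finrank ℂ U = 4) (h : IsDegenerate x L w) :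
    ((∀ u, x 4 u = 0 ∧ x 5 u = 0 ∧ x 0 u = 0 ∧ x 7 u = 0) ∧ ∀ i, i ≠ 0 → w i = 0) ∨
    ((∀ u, x 1 u = 0 ∧ x 2 u = 0 ∧ x 3 u = 0 ∧ x 7 u = 0) ∧ ∀ i, i ≠ 3 → w i = 0) := by
  by_cases h0 : ∃ a, x 0 a ≠ 0
  · obtain ⟨a, ha⟩ := h0
    exact .inr (h.eq_zero_of_apply_ne_zero hU ha)
  by_cases h3 : ∃ a, x 3 a ≠ 0
  · obtain ⟨a, ha⟩ := h3
    left
    obtain ⟨hx, hw⟩ := h.swap.eq_zero_of_apply_ne_zero hU (a := a) ha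
    refine ⟨fun u => by simpa using hx u, ?_⟩
    simp only [Fin.forall_fin_succ, Fin.isValue] at hw
    simp at hw
    intro i hi
    fin_cases i <;> simp_all
  · push Not at h0 h3
    exact (h.not_forall_eq_zero hU h0 h3).elim

end IsDegenerate

end LinearForms

theorem map_mem_pairs14 (g : V8 ≃ₗ[ℂ] V8) {y : ExteriorAlgebra ℂ V8}
    {P : Submodule ℂ V8 × Submodule ℂ V8} (hP : P ∈ pairs14 y) :
    (P.1.map (g : V8 →ₗ[ℂ] V8), P.2.map (g : V8 →ₗ[ℂ] V8)) ∈
      pairs14 (ExteriorAlgebra.map (g : V8 →ₗ[ℂ] V8) y) := by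
  obtain ⟨h1, h4, hle, hy⟩ := hP
  have hspan : ∀ S T U S' T' U' : Submodule ℂ V8, (∀ s ∈ S, g s ∈ S') → (∀ t ∈ T, g t ∈ T') →
      (∀ u ∈ U, g u ∈ U') → wSpan S T U ≤
        (wSpan S' T' U').comap (ExteriorAlgebra.map (g : V8 →ₗ[ℂ] V8)).toLinearMap := by
    intro S T U S' T' U' hS hT hU
    refine Submodule.span_le.2 ?_
    rintro _ ⟨s, hs, t, ht, u, hu, rfl⟩
    exact Submodule.subset_span ⟨g s, hS s hs, g t, hT t ht, g u, hU u hu, by simp⟩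
  have hmap : ∀ S : Submodule ℂ V8, ∀ s ∈ S, g s ∈ S.map (g : V8 →ₗ[ℂ] V8) :=
    fun S s hs => ⟨s, hs, rfl⟩
  refine ⟨by rw [← h1]; exact LinearEquiv.finrank_map_eq g P.1,
    by rw [← h4]; exact LinearEquiv.finrank_map_eq g P.2, Submodule.map_mono hle, ?_⟩
  exact sup_le ((hspan _ _ _ _ _ _ (hmap P.1)
    (fun _ _ => Submodule.mem_top) fun _ _ => Submodule.mem_top).trans
    (Submodule.comap_mono le_sup_left))
    ((hspan _ _ _ _ _ _ (hmap P.2) (hmap P.2)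
    fun _ _ => Submodule.mem_top).trans
    (Submodule.comap_mono le_sup_right)) hy

theorem pairs14_map (g : V8 ≃ₗ[ℂ] V8) (y : ExteriorAlgebra ℂ V8) :
    pairs14 (ExteriorAlgebra.map (g : V8 →ₗ[ℂ] V8) y) =
      Prod.map (Submodule.map (g : V8 →ₗ[ℂ] V8)) (Submodule.map (g : V8 →ₗ[ℂ] V8)) ''
        pairs14 y := by
  refine subset_antisymm (fun P hP => ?_) ?_
  · have h := map_mem_pairs14 g.symm hP
    rw [← AlgHom.comp_apply, ExteriorAlgebra.map_comp_map] at h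
    simp only [LinearEquiv.symm_comp, ExteriorAlgebra.map_id, AlgHom.id_apply] at h
    exact ⟨_, h, by simp [Prod.map, ← Submodule.map_comp]⟩
  · rintro _ ⟨P, hP, rfl⟩
    exact map_mem_pairs14 g hP

theorem contractLeft_contractLeft_ι_mul_ι_mul_ι (a b : Module.Dual ℂ V8) (s t u : V8) :
    CliffordAlgebra.contractLeft (Q := (0 : QuadraticForm ℂ V8)) b
      (CliffordAlgebra.contractLeft (Q := (0 : QuadraticForm ℂ V8)) a (ι ℂ s * ι ℂ t * ι ℂ u)) =
    ι ℂ ((a t * b u - a u * b t) • s + (a u * b s - a s * b u) • t +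
      (a s * b t - a t * b s) • u) := by
  simp only [ι, mul_assoc, CliffordAlgebra.contractLeft_ι_mul, CliffordAlgebra.contractLeft_ι,
    map_sub, map_smul, map_add, Algebra.algebraMap_eq_smul_one, mul_smul_comm, mul_one,
    smul_sub, sub_smul, smul_smul, mul_sub]
  module

theorem exists_contraction_eq_smul {w : V8} {S : Submodule ℂ V8} (hw : w ∈ S)
    {y : ExteriorAlgebra ℂ V8} (hy : y ∈ wSpan (Submodule.span ℂ {w}) ⊤ ⊤ ⊔ wSpan S S ⊤)
    {a b : Module.Dual ℂ V8} (ha : a ∈ S.dualAnnihilator) (hb : b ∈ S.dualAnnihilator) :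
    ∃ c : ℂ, CliffordAlgebra.contractLeft (Q := (0 : QuadraticForm ℂ V8)) b
      (CliffordAlgebra.contractLeft (Q := (0 : QuadraticForm ℂ V8)) a y) = ι ℂ (c • w) := by
  rw [Submodule.mem_dualAnnihilator] at ha hb
  have key : wSpan (Submodule.span ℂ {w}) ⊤ ⊤ ⊔ wSpan S S ⊤ ≤
      ((Submodule.span ℂ {w}).map (ι ℂ)).comap
        (CliffordAlgebra.contractLeft (Q := (0 : QuadraticForm ℂ V8)) b ∘ₗ
          CliffordAlgebra.contractLeft (Q := (0 : QuadraticForm ℂ V8)) a) := by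
    refine sup_le (Submodule.span_le.2 ?_) (Submodule.span_le.2 ?_)
    · rintro _ ⟨s, hs, t, -, u, -, rfl⟩
      have hsS : s ∈ S := (Submodule.span_singleton_le_iff_mem w S).2 hw hs
      refine ⟨_, ?_, (contractLeft_contractLeft_ι_mul_ι_mul_ι a b s t u).symm⟩
      simpa [ha s hsS, hb s hsS] using Submodule.smul_mem _ _ hs
    · rintro _ ⟨s, hs, t, ht, u, -, rfl⟩
      refine ⟨_, ?_, (contractLeft_contractLeft_ι_mul_ι_mul_ι a b s t u).symm⟩
      simp [ha s hs, hb s hs, ha t ht, hb t ht]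
  obtain ⟨_, hm, hx⟩ := key hy
  obtain ⟨c, rfl⟩ := Submodule.mem_span_singleton.1 hm
  exact ⟨c, hx.symm⟩

theorem v_apply (i j : Fin 8) : v i j = if j = i then 1 else 0 := Pi.single_apply i 1 j

theorem eq_sum_smul_v (w : V8) : w = ∑ i, w i • v i := by
  simpa [v] using (Pi.basisFun ℂ (Fin 8)).sum_repr w |>.symm

theorem exists_isDegenerate {w : V8} (hw0 : w ≠ 0) {S : Submodule ℂ V8} (hw : w ∈ S)
    (hy : y3 ∈ wSpan (Submodule.span ℂ {w}) ⊤ ⊤ ⊔ wSpan S S ⊤) :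
    ∃ L, IsDegenerate
      (fun i => (Module.Dual.eval ℂ V8 (v i)).comp S.dualAnnihilator.subtype) L w := by
  obtain ⟨k, hk⟩ := Function.ne_iff.1 hw0
  rw [Pi.zero_apply] at hk
  let L : S.dualAnnihilator → Module.Dual ℂ S.dualAnnihilator := fun a =>
    (w k)⁻¹ • (LinearMap.proj k ∘ₗ ExteriorAlgebra.ιInv ∘ₗ
      (CliffordAlgebra.contractLeft (Q := (0 : QuadraticForm ℂ V8))).flip
        (CliffordAlgebra.contractLeft (Q := (0 : QuadraticForm ℂ V8)) a.1 y3) ∘ₗ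
      S.dualAnnihilator.subtype)
  have hc : ∀ a b : S.dualAnnihilator, ∀ i, (ExteriorAlgebra.ιInv
      (CliffordAlgebra.contractLeft (Q := (0 : QuadraticForm ℂ V8)) b.1
        (CliffordAlgebra.contractLeft (Q := (0 : QuadraticForm ℂ V8)) a.1 y3)) : V8) i =
      w i * L a b := by
    intro a b i
    obtain ⟨c, hc⟩ := exists_contraction_eq_smul hw hy a.2 b.2
    simp only [L, LinearMap.smul_apply, LinearMap.comp_apply, LinearMap.flip_apply,
      Submodule.subtype_apply, LinearMap.proj_apply, smul_eq_mul]
    rw [hc, ι_leftInverse (R := ℂ) (c • w)]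
    simp only [Pi.smul_apply, smul_eq_mul]
    field_simp
  simp only [y3, map_add, contractLeft_contractLeft_ι_mul_ι_mul_ι,
    ι_leftInverse (R := ℂ) (M := V8) _] at hc
  refine ⟨L, fun u hu => ?_, fun u => ?_, ?_, ?_, ?_, ?_, ?_, ?_, ?_, ?_⟩
  · refine Subtype.ext (LinearMap.ext fun z => ?_)
    rw [eq_sum_smul_v z]
    simpa using Finset.sum_eq_zero fun i _ => by
      have := hu i
      simp at this
      simp [this]
  · have := (Submodule.mem_dualAnnihilator _).1 u.2 w hw
    rw [eq_sum_smul_v w] at this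
    simpa using this
  all_goals
    intro a b
    rw [← hc]
    simp only [wedge, v_apply, Pi.add_apply, Pi.smul_apply, smul_eq_mul, Fin.reduceEq, if_true,
      if_false, mul_one, mul_zero, add_zero, zero_add, LinearMap.comp_apply,
      Submodule.subtype_apply, Module.Dual.eval_apply]
    ring

theorem linearIndependent_v : LinearIndependent ℂ v := by
  convert (Pi.basisFun ℂ (Fin 8)).linearIndependent
  exact funext fun i => (Pi.basisFun_apply ℂ (Fin 8) i).symm

theorem finrank_span_image_v (s : Finset (Fin 8)) :
    Module.finrank ℂ (Submodule.span ℂ (v '' s)) = s.card := by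
  have hs : v '' s = Set.range (v ∘ ((↑) : s → Fin 8)) := by
    rw [Set.range_comp, Subtype.range_coe]
  rw [hs, finrank_span_eq_card (linearIndependent_v.comp _ Subtype.val_injective),
    Fintype.card_coe]

theorem finrank_span_v₄ {i j k l : Fin 8} (h : ({i, j, k, l} : Finset (Fin 8)).card = 4) :
    Module.finrank ℂ (Submodule.span ℂ {v i, v j, v k, v l}) = 4 := by
  have hs : ({v i, v j, v k, v l} : Set V8) = v '' ({i, j, k, l} : Finset (Fin 8)) := by
    simp [Set.image_insert_eq]
  rw [hs, finrank_span_image_v, h]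

theorem v_ne_zero (i : Fin 8) : v i ≠ 0 := by simp [v]

theorem span_eq_span_v {w : V8} (hw0 : w ≠ 0) {i : Fin 8} (hw : ∀ j, j ≠ i → w j = 0) :
    Submodule.span ℂ {w} = Submodule.span ℂ {v i} := by
  have h : w = w i • v i := by
    ext j
    by_cases hj : j = i
    · simp [v, hj]
    · simp [v, hj, hw j hj]
  have hi : w i ≠ 0 := fun hi => hw0 (by rw [h, hi, zero_smul])
  rw [h]
  exact Submodule.span_singleton_smul_eq (IsUnit.mk0 _ hi) _

theorem eq_span_v₄ {S : Submodule ℂ V8} (hS : Module.finrank ℂ S = 4) {i j k l : Fin 8}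
    (hc : ({i, j, k, l} : Finset (Fin 8)).card = 4)
    (h : ∀ φ ∈ S.dualAnnihilator, φ (v i) = 0 ∧ φ (v j) = 0 ∧ φ (v k) = 0 ∧ φ (v l) = 0) :
    S = Submodule.span ℂ {v i, v j, v k, v l} := by
  refine (Submodule.eq_of_le_of_finrank_eq (Submodule.span_le.2 ?_)
    ((finrank_span_v₄ hc).trans hS.symm)).symm
  rintro _ (rfl | rfl | rfl | rfl) <;>
    refine (Subspace.forall_mem_dualAnnihilator_apply_eq_zero_iff S _).1 fun φ hφ => ?_
  exacts [(h φ hφ).1, (h φ hφ).2.1, (h φ hφ).2.2.1, (h φ hφ).2.2.2]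

theorem ι_mul_ι_comm (s t : V8) : ι ℂ s * ι ℂ t = -(ι ℂ t * ι ℂ s) :=
  eq_neg_of_add_eq_zero_left (ι_add_mul_swap s t)

theorem ι_mul_ι_mul_ι_rotate (s t u : V8) : ι ℂ s * ι ℂ t * ι ℂ u = ι ℂ t * ι ℂ u * ι ℂ s := by
  rw [mul_assoc (ι ℂ t), ι_mul_ι_comm u s, mul_neg, ← mul_assoc, ι_mul_ι_comm t s, neg_mul,
    neg_neg]

theorem ι_mul_ι_mul_ι_mem_of_left (s t u : V8) (S : Submodule ℂ V8) :
    ι ℂ s * ι ℂ t * ι ℂ u ∈ wSpan (Submodule.span ℂ {s}) ⊤ ⊤ ⊔ wSpan S S ⊤ :=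
  Submodule.mem_sup_left (Submodule.subset_span
    ⟨s, Submodule.mem_span_singleton_self s, t, trivial, u, trivial, rfl⟩)

theorem ι_mul_ι_mul_ι_mem_of_right {A : Set V8} {s t : V8} (hs : s ∈ A) (ht : t ∈ A) (u : V8)
    (T : Submodule ℂ V8) :
    ι ℂ s * ι ℂ t * ι ℂ u ∈
      wSpan T ⊤ ⊤ ⊔ wSpan (Submodule.span ℂ A) (Submodule.span ℂ A) ⊤ :=
  Submodule.mem_sup_right (Submodule.subset_span
    ⟨s, Submodule.subset_span hs, t, Submodule.subset_span ht, u, trivial, rfl⟩)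

theorem mem_pairs14_zero :
    (Submodule.span ℂ {v 0}, Submodule.span ℂ {v 0, v 4, v 5, v 7}) ∈ pairs14 y3 := by
  refine ⟨finrank_span_singleton (v_ne_zero 0), finrank_span_v₄ (by decide),
    Submodule.span_mono (by simp), ?_⟩
  rw [y3, ι_mul_ι_mul_ι_rotate (v 3), ι_mul_ι_mul_ι_rotate (v 1) (v 5),
    ι_mul_ι_mul_ι_rotate (v 2) (v 4)]
  refine add_mem (add_mem (add_mem (add_mem (ι_mul_ι_mul_ι_mem_of_left _ _ _ _) ?_)
    (ι_mul_ι_mul_ι_mem_of_left _ _ _ _)) ?_) ?_ <;>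
  exact ι_mul_ι_mul_ι_mem_of_right (by simp) (by simp) _ _

theorem mem_pairs14_three :
    (Submodule.span ℂ {v 3}, Submodule.span ℂ {v 1, v 2, v 3, v 7}) ∈ pairs14 y3 := by
  refine ⟨finrank_span_singleton (v_ne_zero 3), finrank_span_v₄ (by decide),
    Submodule.span_mono (by simp), ?_⟩
  rw [y3, ι_mul_ι_mul_ι_rotate (v 0) (v 1), ι_mul_ι_mul_ι_rotate (v 0) (v 3),
    ← ι_mul_ι_mul_ι_rotate (v 7) (v 1), ← ι_mul_ι_mul_ι_rotate (v 7) (v 2)]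
  refine add_mem (add_mem (add_mem (add_mem ?_ (ι_mul_ι_mul_ι_mem_of_left _ _ _ _))
    (ι_mul_ι_mul_ι_mem_of_left _ _ _ _)) ?_) ?_ <;>
  exact ι_mul_ι_mul_ι_mem_of_right (by simp) (by simp) _ _

theorem pairs14_y3 :
    pairs14 y3 =
      {(Submodule.span ℂ {v 0}, Submodule.span ℂ {v 0, v 4, v 5, v 7}),
       (Submodule.span ℂ {v 3}, Submodule.span ℂ {v 1, v 2, v 3, v 7})} := by
  refine subset_antisymm ?_
    (Set.insert_subset mem_pairs14_zero (Set.singleton_subset_iff.2 mem_pairs14_three))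
  rintro ⟨T, S⟩ ⟨hT, hS, hle, hy⟩
  dsimp only at hT hS hle hy
  obtain ⟨⟨w, hwT⟩, hw0, hw⟩ := finrank_eq_one_iff'.1 hT
  have hw0' : w ≠ 0 := fun h => hw0 (Subtype.ext h)
  obtain rfl : T = Submodule.span ℂ {w} :=
    le_antisymm (fun z hz => by
      obtain ⟨c, hc⟩ := hw ⟨z, hz⟩
      exact Submodule.mem_span_singleton.2 ⟨c, congrArg Subtype.val hc⟩)
      ((Submodule.span_singleton_le_iff_mem w T).2 hwT)
  obtain ⟨L, hL⟩ := exists_isDegenerate hw0' (hle hwT) hy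
  have hU : Module.finrank ℂ S.dualAnnihilator = 4 := by
    have := Subspace.finrank_add_finrank_dualAnnihilator_eq S
    simp [hS] at this
    omega
  rcases hL.cases hU with ⟨hx, hw⟩ | ⟨hx, hw⟩
  · left
    rw [span_eq_span_v hw0' hw, eq_span_v₄ hS (i := 0) (j := 4) (k := 5) (l := 7) (by decide)]
    intro φ hφ
    obtain ⟨h4, h5, h0, h7⟩ := hx ⟨φ, hφ⟩
    exact ⟨h0, h4, h5, h7⟩
  · right
    rw [Set.mem_singleton_iff, span_eq_span_v hw0' hw,
      eq_span_v₄ hS (i := 1) (j := 2) (k := 3) (l := 7) (by decide) fun φ hφ => hx ⟨φ, hφ⟩]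

theorem two_pairs_over_Y3 :
    (∀ g : V8 ≃ₗ[ℂ] V8, (pairs14 (ExteriorAlgebra.map (g : V8 →ₗ[ℂ] V8) y3)).encard = 2) ∧
    pairs14 y3 =
      {(Submodule.span ℂ {v 0}, Submodule.span ℂ {v 0, v 4, v 5, v 7}),
       (Submodule.span ℂ {v 3}, Submodule.span ℂ {v 1, v 2, v 3, v 7})} := by
  refine ⟨fun g => ?_, pairs14_y3⟩
  have hinj := Submodule.map_injective_of_injective (f := (g : V8 →ₗ[ℂ] V8)) g.injective
  rw [pairs14_map, (hinj.prodMap hinj).encard_image, pairs14_y3]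
  refine Set.encard_pair fun h => ?_
  have h0 : v 0 ∈ Submodule.span ℂ {v 3} := by
    rw [← (Prod.mk.inj h).1]
    exact Submodule.mem_span_singleton_self _
  obtain ⟨c, hc⟩ := Submodule.mem_span_singleton.1 h0
  simpa [v] using congrFun hc 0
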